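/- Let 0 < p < 1/2 and let E₁* be the unique bounded solution of E(q) = 1 + r(q)·E(f₁(q)) on [0,1]. Then E₁*(q) ≥ 2 for all q with p < q < 1 − p, while for all ε with 0 < ε < p², E₁*(1 − p + ε) = 1 + p + p²·E₁*(ε/p²) ≤ 1 + 2p and E₁*(p − ε) = 1 + p + p²·E₁*(1 − ε/p²) ≤ 1 + 2p. Consequently, E₁* is discontinuous at both p and 1 − p. -/

import Mathlib

noncomputable section

/-- The rescaling map `f₁`. -/
def f1 (p q : ℝ) : ℝ :=
  if q ≤ p then q / p
  else if q < 1 - p then (q - p) / (1 - p)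
  else (q - (1 - p)) / p

/-- The continuation probability `r`. -/
def r (p q : ℝ) : ℝ := if p < q ∧ q < 1 - p then 1 - p else p

/-- The unique bounded solution of `E(q) = 1 + r(q)·E(f₁(q))`, given by
`E₁*(q) = Σ_{n=0}^∞ Π_{j=0}^{n-1} r(f₁^j(q))`. -/
def E1star (p q : ℝ) : ℝ := ∑' n : ℕ, ∏ j ∈ Finset.range n, r p ((f1 p)^[j] q)

theorem r_eq_of_le {p q : ℝ} (h : q ≤ p) : r p q = p :=
  if_neg fun h' => absurd h'.1 h.not_gt

theorem r_eq_of_ge {p q : ℝ} (h : 1 - p ≤ q) : r p q = p :=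
  if_neg fun h' => absurd h'.2 h.not_gt

theorem r_mem_Icc {p : ℝ} (hp' : p < 1 / 2) (q : ℝ) : r p q ∈ Set.Icc p (1 - p) := by
  unfold r
  split_ifs <;> constructor <;> linarith

theorem f1_of_le {p q : ℝ} (h : q ≤ p) : f1 p q = q / p := if_pos h

theorem f1_of_ge {p q : ℝ} (hp' : p < 1 / 2) (h : 1 - p ≤ q) :
    f1 p q = (q - (1 - p)) / p := by
  rw [f1, if_neg (by linarith), if_neg h.not_gt]

theorem prod_r_le {p : ℝ} (hp : 0 < p) (hp' : p < 1 / 2) (q : ℝ) (n : ℕ) :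
    ∏ j ∈ Finset.range n, r p ((f1 p)^[j] q) ≤ (1 - p) ^ n :=
  (Finset.prod_le_prod (fun _ _ => hp.le.trans (r_mem_Icc hp' _).1)
    fun _ _ => (r_mem_Icc hp' _).2).trans_eq (by simp)

theorem pow_le_prod_r {p : ℝ} (hp : 0 < p) (hp' : p < 1 / 2) (q : ℝ) (n : ℕ) :
    p ^ n ≤ ∏ j ∈ Finset.range n, r p ((f1 p)^[j] q) :=
  le_trans (by simp) (Finset.prod_le_prod (fun _ _ => hp.le) fun _ _ => (r_mem_Icc hp' _).1)

theorem summable_prod_r {p : ℝ} (hp : 0 < p) (hp' : p < 1 / 2) (q : ℝ) :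
    Summable fun n : ℕ => ∏ j ∈ Finset.range n, r p ((f1 p)^[j] q) :=
  .of_nonneg_of_le (fun n => (pow_nonneg hp.le n).trans (pow_le_prod_r hp hp' q n))
    (prod_r_le hp hp' q) (summable_geometric_of_lt_one (by linarith) (by linarith))

theorem E1star_le {p : ℝ} (hp : 0 < p) (hp' : p < 1 / 2) (q : ℝ) : E1star p q ≤ p⁻¹ := by
  have h := (summable_prod_r hp hp' q).tsum_le_tsum (prod_r_le hp hp' q)
    (summable_geometric_of_lt_one (by linarith) (by linarith))
  rwa [tsum_geometric_of_lt_one (by linarith) (by linarith), sub_sub_cancel] at h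

theorem le_E1star {p : ℝ} (hp : 0 < p) (hp' : p < 1 / 2) (q : ℝ) :
    (1 - p)⁻¹ ≤ E1star p q := by
  rw [← tsum_geometric_of_lt_one hp.le (by linarith)]
  exact (summable_geometric_of_lt_one hp.le (by linarith)).tsum_le_tsum
    (pow_le_prod_r hp hp' q) (summable_prod_r hp hp' q)

theorem E1star_eq {p : ℝ} (hp : 0 < p) (hp' : p < 1 / 2) (q : ℝ) :
    E1star p q = 1 + r p q * E1star p (f1 p q) := by
  rw [E1star, (summable_prod_r hp hp' q).tsum_eq_zero_add, E1star, ← tsum_mul_left]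
  simp [Finset.prod_range_succ', mul_comm]

theorem two_le_E1star {p q : ℝ} (hp : 0 < p) (hp' : p < 1 / 2) (h₁ : p < q) (h₂ : q < 1 - p) :
    2 ≤ E1star p q := by
  have h1p : 0 < 1 - p := by linarith
  have h := mul_le_mul_of_nonneg_left (le_E1star hp hp' (f1 p q)) h1p.le
  rw [mul_inv_cancel₀ h1p.ne'] at h
  rw [E1star_eq hp hp', r, if_pos ⟨h₁, h₂⟩]
  linarith

theorem one_add_add_sq_mul_E1star_le {p : ℝ} (hp : 0 < p) (hp' : p < 1 / 2) (q : ℝ) :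
    1 + p + p ^ 2 * E1star p q ≤ 1 + 2 * p := by
  have h := mul_le_mul_of_nonneg_left (E1star_le hp hp' q) (sq_nonneg p)
  rw [sq, mul_inv_cancel_right₀ hp.ne', ← sq] at h
  linarith

theorem E1star_one_sub_add {p ε : ℝ} (hp : 0 < p) (hp' : p < 1 / 2) (hε : 0 < ε)
    (hε' : ε < p ^ 2) :
    E1star p (1 - p + ε) = 1 + p + p ^ 2 * E1star p (ε / p ^ 2) := by
  have h₁ : 1 - p ≤ 1 - p + ε := by linarith
  have h₂ : ε / p ≤ p := by rw [div_le_iff₀ hp]; nlinarith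
  rw [E1star_eq hp hp', r_eq_of_ge h₁, f1_of_ge hp' h₁, add_sub_cancel_left, E1star_eq hp hp',
    r_eq_of_le h₂, f1_of_le h₂, div_div, ← sq]
  ring

theorem E1star_sub {p ε : ℝ} (hp : 0 < p) (hp' : p < 1 / 2) (hε : 0 < ε)
    (hε' : ε < p ^ 2) :
    E1star p (p - ε) = 1 + p + p ^ 2 * E1star p (1 - ε / p ^ 2) := by
  have h₁ : p - ε ≤ p := by linarith
  have h₂ : 1 - p ≤ (p - ε) / p := by rw [le_div_iff₀ hp]; nlinarith
  have h₃ : ((p - ε) / p - (1 - p)) / p = 1 - ε / p ^ 2 := by field_simp; ring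
  rw [E1star_eq hp hp', r_eq_of_le h₁, f1_of_le h₁, E1star_eq hp hp',
    r_eq_of_ge h₂, f1_of_ge hp' h₂, h₃]
  ring

/-- A function bounded above by `a` on `s` and below by `b > a` on `t` is discontinuous at every
common limit point of `s` and `t`. -/
theorem not_continuousWithinAt_of_separated {f : ℝ → ℝ} {s t u : Set ℝ} {x a b : ℝ} (hab : a < b)
    (hs : s ⊆ u) (ht : t ⊆ u) (hxs : x ∈ closure s) (hxt : x ∈ closure t)
    (hfs : ∀ y ∈ s, f y ≤ a) (hft : ∀ y ∈ t, b ≤ f y) : ¬ ContinuousWithinAt f u x := by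
  intro h
  have := mem_closure_iff_nhdsWithin_neBot.1 hxs
  have := mem_closure_iff_nhdsWithin_neBot.1 hxt
  have h₁ := le_of_tendsto (h.mono hs) (eventually_mem_nhdsWithin.mono hfs)
  have h₂ := ge_of_tendsto (h.mono ht) (eventually_mem_nhdsWithin.mono hft)
  linarith

/-- `E₁* ≥ 2` on `(p, 1-p)`; for `0 < ε < p²`,
`E₁*(1-p+ε) = 1+p+p²·E₁*(ε/p²) ≤ 1+2p` and `E₁*(p-ε) = 1+p+p²·E₁*(1-ε/p²) ≤ 1+2p`;
consequently `E₁*` is discontinuous (within `[0,1]`) at both `p` and `1-p`. -/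
theorem E1star_discontinuous_at_p_and_one_sub_p (p : ℝ) (hp : 0 < p) (hp' : p < 1 / 2) :
    (∀ q : ℝ, p < q → q < 1 - p → 2 ≤ E1star p q) ∧
    (∀ ε : ℝ, 0 < ε → ε < p ^ 2 →
      (E1star p (1 - p + ε) = 1 + p + p ^ 2 * E1star p (ε / p ^ 2) ∧
        E1star p (1 - p + ε) ≤ 1 + 2 * p) ∧
      (E1star p (p - ε) = 1 + p + p ^ 2 * E1star p (1 - ε / p ^ 2) ∧
        E1star p (p - ε) ≤ 1 + 2 * p)) ∧
    ¬ ContinuousWithinAt (E1star p) (Set.Icc 0 1) p ∧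
    ¬ ContinuousWithinAt (E1star p) (Set.Icc 0 1) (1 - p) := by
  have left (q : ℝ) (hq : q ∈ Set.Ioo (p - p ^ 2) p) : E1star p q ≤ 1 + 2 * p := by
    have h := E1star_sub (ε := p - q) hp hp' (by linarith [hq.2]) (by linarith [hq.1])
    rw [sub_sub_cancel] at h
    exact h.trans_le (one_add_add_sq_mul_E1star_le hp hp' _)
  have right (q : ℝ) (hq : q ∈ Set.Ioo (1 - p) (1 - p + p ^ 2)) : E1star p q ≤ 1 + 2 * p := by
    have h := E1star_one_sub_add (ε := q - (1 - p)) hp hp' (by linarith [hq.1])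
      (by linarith [hq.2])
    rw [add_sub_cancel] at h
    exact h.trans_le (one_add_add_sq_mul_E1star_le hp hp' _)
  have middle (q : ℝ) (hq : q ∈ Set.Ioo p (1 - p)) : 2 ≤ E1star p q :=
    two_le_E1star hp hp' hq.1 hq.2
  have hsq : 0 < p ^ 2 := by positivity
  have hsq' : p ^ 2 < p := by nlinarith
  have hmid : Set.Ioo p (1 - p) ⊆ Set.Icc 0 1 := fun q hq =>
    ⟨by linarith [hq.1], by linarith [hq.2]⟩
  refine ⟨fun q => two_le_E1star hp hp', fun ε hε hε' => ?_, ?_, ?_⟩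
  · have h₁ := E1star_one_sub_add hp hp' hε hε'
    have h₂ := E1star_sub hp hp' hε hε'
    exact ⟨⟨h₁, h₁.trans_le (one_add_add_sq_mul_E1star_le hp hp' _)⟩,
      h₂, h₂.trans_le (one_add_add_sq_mul_E1star_le hp hp' _)⟩
  · refine not_continuousWithinAt_of_separated (by linarith : 1 + 2 * p < 2)
      (fun q hq => ⟨by linarith [hq.1], by linarith [hq.2]⟩) hmid ?_ ?_ left middle
    · rw [closure_Ioo (by linarith)]
      exact ⟨by linarith, le_rfl⟩
    · rw [closure_Ioo (by linarith)]
      exact ⟨le_rfl, by linarith⟩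
  · refine not_continuousWithinAt_of_separated (by linarith : 1 + 2 * p < 2)
      (fun q hq => ⟨by linarith [hq.1], by linarith [hq.2]⟩) hmid ?_ ?_ right middle
    · rw [closure_Ioo (by linarith)]
      exact ⟨le_rfl, by linarith⟩
    · rw [closure_Ioo (by linarith)]
      exact ⟨by linarith, le_rfl⟩
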